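/- Let H be a real Hilbert space and let P ⊆ H be a σ-porous set. Then P is Γ₁-null: the set of curves γ ∈ Γ₁(H) for which the outer Lebesgue measure of {t ∈ [0,1] : γ(t) ∈ P} is zero is residual (comeager) in Γ₁(H). -/

import Mathlib

open Set MeasureTheory Metric Topology
open scoped ENNReal

noncomputable section

/-- The space `Γ₁(H)` of `C¹` curves `[0,1] → H`, encoded as pairs
`(γ, γ')` of continuous maps such that `γ'` is the (one-sided at the endpoints)
derivative of `γ` on `[0,1]`. -/
def Gamma1 (H : Type*) [NormedAddCommGroup H] [NormedSpace ℝ H] : Type _ :=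
  {p : C(Icc (0:ℝ) 1, H) × C(Icc (0:ℝ) 1, H) //
    ∀ t ∈ Icc (0:ℝ) 1,
      HasDerivWithinAt (IccExtend zero_le_one ⇑p.1) (IccExtend zero_le_one ⇑p.2 t) (Icc 0 1) t}

/-- The metric on `Γ₁(H)` induced by the norm `‖γ‖_∞ + ‖γ'‖_∞`. -/
noncomputable instance Gamma1.metricSpace (H : Type*) [NormedAddCommGroup H]
    [NormedSpace ℝ H] : MetricSpace (Gamma1 H) where
  dist f g := ‖f.1.1 - g.1.1‖ + ‖f.1.2 - g.1.2‖
  dist_self f := by simp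
  dist_comm f g := by
    simp only [norm_sub_rev f.1.1 g.1.1, norm_sub_rev f.1.2 g.1.2]
  dist_triangle f g h := by
    change ‖f.1.1 - h.1.1‖ + ‖f.1.2 - h.1.2‖ ≤
      (‖f.1.1 - g.1.1‖ + ‖f.1.2 - g.1.2‖) + (‖g.1.1 - h.1.1‖ + ‖g.1.2 - h.1.2‖)
    have h1 := dist_triangle f.1.1 g.1.1 h.1.1
    have h2 := dist_triangle f.1.2 g.1.2 h.1.2
    simp only [dist_eq_norm] at h1 h2
    linarith
  eq_of_dist_eq_zero := by
    intro f g hfg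
    change ‖f.1.1 - g.1.1‖ + ‖f.1.2 - g.1.2‖ = 0 at hfg
    have n1 := norm_nonneg (f.1.1 - g.1.1)
    have n2 := norm_nonneg (f.1.2 - g.1.2)
    have e1 : ‖f.1.1 - g.1.1‖ = 0 := by linarith
    have e2 : ‖f.1.2 - g.1.2‖ = 0 := by linarith
    have q1 : f.1.1 = g.1.1 := sub_eq_zero.mp (norm_eq_zero.mp e1)
    have q2 : f.1.2 = g.1.2 := sub_eq_zero.mp (norm_eq_zero.mp e2)
    exact Subtype.ext (Prod.ext q1 q2)

/-- The outer Lebesgue measure of the set of times `t ∈ [0,1]` at which a curve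
`γ ∈ Γ₁(H)` lies in the set `E`. -/
def Gamma1.measOn {H : Type*} [NormedAddCommGroup H] [NormedSpace ℝ H]
    (γ : Gamma1 H) (E : Set H) : ℝ≥0∞ :=
  volume (Subtype.val '' (⇑γ.1.1 ⁻¹' E))


/-- `E` is `c`-porous: at every point `x ∈ E` and every scale `ε > 0` there is a hole
`B(h,r)` of `E` with `d(x,h) < ε` and `r > c · d(x,h)`. -/
def IsCPorous {M : Type*} [MetricSpace M] (c : ℝ) (E : Set M) : Prop :=
  ∀ x ∈ E, ∀ ε > 0, ∃ h : M, ∃ r > 0,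
    dist x h < ε ∧ Metric.ball h r ∩ E = ∅ ∧ r > c * dist x h

/-- A set is σ-porous if it is a countable union of porous sets. -/
def IsSigmaPorous {M : Type*} [MetricSpace M] (P : Set M) : Prop :=
  ∃ E : ℕ → Set M, P = ⋃ n, E n ∧ ∀ n, ∃ c : ℝ, 0 < c ∧ c < 1 ∧ IsCPorous c (E n)

/-- A `C¹` bump function on the line, supported in `[-1, 1]` and equal to `1` at `0`. -/
lemma exists_contDiff_bump :
    ∃ (b b' : ℝ → ℝ) (B : ℝ), 1 ≤ B ∧ Continuous b' ∧ (∀ x, HasDerivAt b (b' x) x) ∧ b 0 = 1 ∧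
      (∀ x, |b x| ≤ 1) ∧ (∀ x, |b' x| ≤ B) ∧ ∀ x, 1 ≤ |x| → b x = 0 ∧ b' x = 0 := by
  let f : ContDiffBump (0 : ℝ) := ⟨1 / 2, 1, by norm_num, by norm_num⟩
  have hf : ContDiff ℝ 1 f := f.contDiff
  have hc : Continuous (deriv f) := hf.continuous_deriv le_rfl
  obtain ⟨C, hC⟩ := f.hasCompactSupport.deriv.exists_bound_of_continuous hc
  have hzero : ∀ x : ℝ, 1 ≤ |x| → f x = 0 := fun x hx ↦
    f.zero_of_le_dist (by simpa [Real.dist_eq] using hx)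
  refine ⟨f, deriv f, max 1 C, le_max_left _ _, hc,
    fun x ↦ (hf.differentiable one_ne_zero x).hasDerivAt,
    f.one_of_mem_closedBall (by simp [f.rIn_pos.le]), fun x ↦ ?_,
    fun x ↦ (hC x).trans (le_max_right _ _), fun x hx ↦ ⟨hzero x hx, ?_⟩⟩
  · rw [abs_of_nonneg f.nonneg]
    exact f.le_one
  · refine IsLocalMin.deriv_eq_zero (Filter.Eventually.of_forall fun y ↦ ?_)
    rw [hzero x hx]
    exact f.nonneg

namespace Gamma1

section Basic

variable {H : Type*} [NormedAddCommGroup H] [NormedSpace ℝ H]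

/-- The curve, extended to the whole line by constants. -/
def curve (γ : Gamma1 H) : ℝ → H := IccExtend zero_le_one γ.1.1

/-- The velocity of the curve, extended to the whole line by constants. -/
def velocity (γ : Gamma1 H) : ℝ → H := IccExtend zero_le_one γ.1.2

lemma continuous_curve (γ : Gamma1 H) : Continuous γ.curve := γ.1.1.continuous.Icc_extend'

lemma continuous_velocity (γ : Gamma1 H) : Continuous γ.velocity := γ.1.2.continuous.Icc_extend'

lemma hasDerivWithinAt_curve (γ : Gamma1 H) {t : ℝ} (ht : t ∈ Icc (0 : ℝ) 1) :
    HasDerivWithinAt γ.curve (γ.velocity t) (Icc 0 1) t := γ.2 t ht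

lemma norm_curve_sub_le (γ₁ γ₂ : Gamma1 H) (t : ℝ) :
    ‖γ₁.curve t - γ₂.curve t‖ ≤ ‖γ₁.1.1 - γ₂.1.1‖ :=
  (γ₁.1.1 - γ₂.1.1).norm_coe_le_norm (projIcc 0 1 zero_le_one t)

lemma norm_velocity_sub_le (γ₁ γ₂ : Gamma1 H) (t : ℝ) :
    ‖γ₁.velocity t - γ₂.velocity t‖ ≤ ‖γ₁.1.2 - γ₂.1.2‖ :=
  (γ₁.1.2 - γ₂.1.2).norm_coe_le_norm (projIcc 0 1 zero_le_one t)

lemma dist_def (γ₁ γ₂ : Gamma1 H) :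
    dist γ₁ γ₂ = ‖γ₁.1.1 - γ₂.1.1‖ + ‖γ₁.1.2 - γ₂.1.2‖ := rfl

lemma continuous_position : Continuous fun γ : Gamma1 H ↦ γ.1.1 :=
  (LipschitzWith.of_dist_le_mul (K := 1) fun γ₁ γ₂ ↦ by
    rw [dist_def, dist_eq_norm]
    simp).continuous

lemma continuous_speed : Continuous fun γ : Gamma1 H ↦ γ.1.2 :=
  (LipschitzWith.of_dist_le_mul (K := 1) fun γ₁ γ₂ ↦ by
    rw [dist_def, dist_eq_norm]
    simp).continuous

lemma norm_curve_sub_curve_le (γ : Gamma1 H) {C : ℝ} (hC : ∀ t ∈ Icc (0 : ℝ) 1, ‖γ.velocity t‖ ≤ C)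
    {s t : ℝ} (hs : s ∈ Icc (0 : ℝ) 1) (ht : t ∈ Icc (0 : ℝ) 1) :
    ‖γ.curve s - γ.curve t‖ ≤ C * |s - t| :=
  (convex_Icc 0 1).norm_image_sub_le_of_norm_hasDerivWithin_le
    (fun _ hx ↦ γ.hasDerivWithinAt_curve hx) hC ht hs

lemma measOn_eq (γ : Gamma1 H) (E : Set H) :
    γ.measOn E = volume (Icc 0 1 ∩ γ.curve ⁻¹' E) := by
  unfold measOn
  congr 1
  ext t
  simp only [mem_image, mem_preimage, Subtype.exists, exists_and_right, exists_eq_right,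
    mem_inter_iff]
  constructor
  · rintro ⟨ht, h⟩
    exact ⟨ht, by rwa [curve, IccExtend_of_mem _ _ ht]⟩
  · rintro ⟨ht, h⟩
    exact ⟨ht, by rwa [curve, IccExtend_of_mem _ _ ht] at h⟩

/-- Adding a `C¹` map to a curve. -/
lemma exists_curve_eq_add (γ : Gamma1 H) {p p' : ℝ → H} (hp' : Continuous p')
    (hp : ∀ t, HasDerivAt p (p' t) t) :
    ∃ ξ : Gamma1 H, (∀ t ∈ Icc (0 : ℝ) 1, ξ.curve t = γ.curve t + p t) ∧
      ∀ t ∈ Icc (0 : ℝ) 1, ξ.velocity t = γ.velocity t + p' t := by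
  have hpc : Continuous p := continuous_iff_continuousAt.2 fun t ↦ (hp t).continuousAt
  let q : C(Icc (0 : ℝ) 1, H) := γ.1.1 + ⟨fun t ↦ p t, by fun_prop⟩
  let q' : C(Icc (0 : ℝ) 1, H) := γ.1.2 + ⟨fun t ↦ p' t, by fun_prop⟩
  have h1 : ∀ t ∈ Icc (0 : ℝ) 1, IccExtend zero_le_one q t = γ.curve t + p t := fun t ht ↦ by
    simp [IccExtend_of_mem _ _ ht, curve, q]
  have h2 : ∀ t ∈ Icc (0 : ℝ) 1, IccExtend zero_le_one q' t = γ.velocity t + p' t :=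
    fun t ht ↦ by simp [IccExtend_of_mem _ _ ht, velocity, q']
  refine ⟨⟨(q, q'), fun t ht ↦ ?_⟩, h1, h2⟩
  rw [h2 t ht]
  exact ((γ.hasDerivWithinAt_curve ht).add (hp t).hasDerivWithinAt).congr h1 (h1 t ht)

lemma norm_position_sub_le_of_forall {γ₁ γ₂ : Gamma1 H} {C : ℝ} (hC : 0 ≤ C)
    (h : ∀ t ∈ Icc (0 : ℝ) 1, ‖γ₁.curve t - γ₂.curve t‖ ≤ C) : ‖γ₁.1.1 - γ₂.1.1‖ ≤ C :=
  (ContinuousMap.norm_le _ hC).2 fun t ↦ by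
    simpa [curve, IccExtend_of_mem _ _ t.2] using h t t.2

lemma norm_speed_sub_le_of_forall {γ₁ γ₂ : Gamma1 H} {C : ℝ} (hC : 0 ≤ C)
    (h : ∀ t ∈ Icc (0 : ℝ) 1, ‖γ₁.velocity t - γ₂.velocity t‖ ≤ C) : ‖γ₁.1.2 - γ₂.1.2‖ ≤ C :=
  (ContinuousMap.norm_le _ hC).2 fun t ↦ by
    simpa [velocity, IccExtend_of_mem _ _ t.2] using h t t.2

/-- The integrand of `Gamma1.gain`. -/
def gainDensity (G : Set H) (lam : ℝ) (γ₀ γ : Gamma1 H) (t : ℝ) : ℝ :=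
  (γ.curve ⁻¹' G).indicator 1 t - lam * ‖γ.velocity t - γ₀.velocity t‖ ^ 2

/-- The time spent by `γ` in `G`, minus `lam` times the energy of `γ - γ₀`. -/
def gain (G : Set H) (lam : ℝ) (γ₀ γ : Gamma1 H) : ℝ :=
  ∫ t in Icc 0 1, gainDensity G lam γ₀ γ t

lemma integrableOn_energy (γ₀ γ : Gamma1 H) {s : Set ℝ} (hs : IsCompact s) :
    IntegrableOn (fun t ↦ ‖γ.velocity t - γ₀.velocity t‖ ^ 2) s :=
  ((γ.continuous_velocity.sub γ₀.continuous_velocity).norm.pow 2).continuousOn.integrableOn_compact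
    hs

lemma integrableOn_indicator_preimage (γ : Gamma1 H) {G : Set H} (hG : IsOpen G) {s : Set ℝ}
    (hs : IsCompact s) : IntegrableOn ((γ.curve ⁻¹' G).indicator (1 : ℝ → ℝ)) s :=
  (integrableOn_const hs.measure_lt_top.ne).indicator
    (hG.preimage γ.continuous_curve).measurableSet

lemma integrableOn_gainDensity {G : Set H} (hG : IsOpen G) (lam : ℝ) (γ₀ γ : Gamma1 H)
    {s : Set ℝ} (hs : IsCompact s) : IntegrableOn (gainDensity G lam γ₀ γ) s :=
  (γ.integrableOn_indicator_preimage hG hs).sub ((integrableOn_energy γ₀ γ hs).const_mul lam)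

lemma gain_eq {G : Set H} (hG : IsOpen G) (lam : ℝ) (γ₀ γ : Gamma1 H) :
    gain G lam γ₀ γ = volume.real (Icc 0 1 ∩ γ.curve ⁻¹' G) -
      lam * ∫ t in Icc 0 1, ‖γ.velocity t - γ₀.velocity t‖ ^ 2 := by
  have hm : MeasurableSet (γ.curve ⁻¹' G) := (hG.preimage γ.continuous_curve).measurableSet
  unfold gain gainDensity
  rw [integral_sub (γ.integrableOn_indicator_preimage hG isCompact_Icc)
    ((integrableOn_energy γ₀ γ isCompact_Icc).const_mul lam), integral_const_mul,
    integral_indicator_one hm, measureReal_restrict_apply hm, inter_comm]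

lemma lowerSemicontinuous_volume_preimage {G : Set H} (hG : IsOpen G) :
    LowerSemicontinuous fun γ : Gamma1 H ↦ volume.real (Icc 0 1 ∩ γ.curve ⁻¹' G) := by
  have hfin : ∀ s : Set ℝ, volume (Icc 0 1 ∩ s) ≠ ∞ := fun s ↦
    ((measure_mono inter_subset_left).trans_lt isCompact_Icc.measure_lt_top).ne
  intro γ r hr
  rcases lt_or_ge r 0 with hr0 | hr0
  · exact Filter.Eventually.of_forall fun _ ↦ hr0.trans_le measureReal_nonneg
  have hr' : ENNReal.ofReal r < volume (Icc 0 1 ∩ γ.curve ⁻¹' G) :=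
    (ENNReal.ofReal_lt_iff_lt_toReal hr0 (hfin _)).2 hr
  obtain ⟨K, hK, hKc, hrK⟩ := (measurableSet_Icc.inter
    (hG.preimage γ.continuous_curve).measurableSet).exists_lt_isCompact hr'
  obtain ⟨ε, hε, hsub⟩ := (hKc.image γ.continuous_curve).exists_thickening_subset_open hG
    (image_subset_iff.2 fun t ht ↦ (hK ht).2)
  filter_upwards [Metric.ball_mem_nhds γ hε] with ξ hξ
  refine (ENNReal.ofReal_lt_iff_lt_toReal hr0 (hfin _)).1 (hrK.trans_le (measure_mono fun t ht ↦
    ⟨(hK ht).1, hsub (Metric.mem_thickening_iff.2 ⟨_, mem_image_of_mem _ ht, ?_⟩)⟩))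
  rw [dist_eq_norm]
  refine (norm_curve_sub_le ξ γ t).trans_lt (lt_of_le_of_lt ?_ (Metric.mem_ball.1 hξ))
  rw [dist_def]
  exact le_add_of_nonneg_right (norm_nonneg _)

lemma continuous_energy (γ₀ : Gamma1 H) :
    Continuous fun γ : Gamma1 H ↦ ∫ t in Icc 0 1, ‖γ.velocity t - γ₀.velocity t‖ ^ 2 := by
  refine continuous_iff_continuousAt.2 fun γ ↦ continuousAt_of_dominated
    (bound := fun _ ↦ (‖γ.1.2 - γ₀.1.2‖ + 1) ^ 2) (Filter.Eventually.of_forall fun ξ ↦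
      (integrableOn_energy γ₀ ξ isCompact_Icc).aestronglyMeasurable) ?_
    (integrableOn_const isCompact_Icc.measure_lt_top.ne)
    (Filter.Eventually.of_forall fun t ↦ ?_)
  · have hc : Continuous fun ξ : Gamma1 H ↦ ‖ξ.1.2 - γ₀.1.2‖ :=
      (continuous_speed.sub continuous_const).norm
    filter_upwards [hc.continuousAt.eventually_lt_const (lt_add_one ‖γ.1.2 - γ₀.1.2‖)] with ξ hξ
    refine Filter.Eventually.of_forall fun t ↦ ?_
    rw [Real.norm_of_nonneg (by positivity)]
    exact pow_le_pow_left₀ (norm_nonneg _) ((norm_velocity_sub_le ξ γ₀ t).trans hξ.le) 2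
  · have hv : Continuous fun ξ : Gamma1 H ↦ ξ.velocity t :=
      (continuous_eval_const (projIcc 0 1 zero_le_one t)).comp continuous_speed
    exact ((hv.sub continuous_const).norm.pow 2).continuousAt

lemma lowerSemicontinuous_gain {G : Set H} (hG : IsOpen G) (lam : ℝ) (γ₀ : Gamma1 H) :
    LowerSemicontinuous (gain G lam γ₀) := by
  have h := (lowerSemicontinuous_volume_preimage hG).add
    ((continuous_energy γ₀).const_mul lam).neg.lowerSemicontinuous
  refine (funext fun γ ↦ ?_ : gain G lam γ₀ = _) ▸ h
  rw [gain_eq hG, sub_eq_add_neg, Pi.neg_apply]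

lemma gain_self_nonneg {G : Set H} (hG : IsOpen G) (lam : ℝ) (γ₀ : Gamma1 H) :
    0 ≤ gain G lam γ₀ γ₀ := by
  simp [gain_eq hG]

lemma gain_add_energy_le_one {G : Set H} (hG : IsOpen G) (lam : ℝ) (γ₀ γ : Gamma1 H) :
    gain G lam γ₀ γ + lam * ∫ t in Icc 0 1, ‖γ.velocity t - γ₀.velocity t‖ ^ 2 ≤ 1 := by
  rw [gain_eq hG, sub_add_cancel]
  refine (measureReal_mono inter_subset_left isCompact_Icc.measure_lt_top.ne).trans ?_
  simp

end Basic

section Perturbation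

variable {H : Type*} [NormedAddCommGroup H] [InnerProductSpace ℝ H]

/-- Up to a term linear in `q`, adding a vector `q • u` with `‖q • u‖ ≤ η` to a vector `w`
at distance at most `η` from `w₀` increases the energy by at most `3 * η ^ 2`. -/
lemma norm_add_smul_sq_sub_le {w w₀ u : H} {q η : ℝ} (hq : |q| * ‖u‖ ≤ η) (hw : ‖w - w₀‖ ≤ η) :
    ‖w + q • u‖ ^ 2 - ‖w‖ ^ 2 ≤ q * (2 * inner ℝ w₀ u) + 3 * η ^ 2 := by
  have h0 : 0 ≤ |q| * ‖u‖ := by positivity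
  have h1 : ‖q • u‖ ^ 2 ≤ η ^ 2 := by
    rw [norm_smul, Real.norm_eq_abs]
    exact pow_le_pow_left₀ h0 hq 2
  have h2 : inner ℝ (w - w₀) (q • u) ≤ η * η := by
    refine (real_inner_le_norm _ _).trans (mul_le_mul hw ?_ (norm_nonneg _) (h0.trans hq))
    rwa [norm_smul, Real.norm_eq_abs]
  rw [inner_sub_left, inner_smul_right w₀] at h2
  rw [norm_add_sq_real]
  nlinarith

lemma le_setIntegral_gainDensity_sub {G : Set H} (hG : IsOpen G) {lam η κ t L a : ℝ}
    (hlam : 0 ≤ lam) (hL : 0 ≤ L) (ha : 0 ≤ a) (haL : a ≤ L) {γ₀ γ ξ : Gamma1 H} {q : ℝ → ℝ}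
    {u : H} (hq : Continuous q) (hq0 : ∫ τ in closedBall t L, q τ = 0)
    (hqη : ∀ τ, |q τ| * ‖u‖ ≤ η)
    (hξ : ∀ τ ∈ closedBall t L, ξ.velocity τ = γ.velocity τ + q τ • u)
    (hosc : ∀ τ ∈ closedBall t L,
      ‖(γ.velocity τ - γ₀.velocity τ) - (γ.velocity t - γ₀.velocity t)‖ ≤ η)
    (hξG : ∀ τ ∈ ball t a, ξ.curve τ ∈ G)
    (hγG : volume.real (γ.curve ⁻¹' G ∩ closedBall t L) ≤ κ * (2 * L)) :
    2 * a - κ * (2 * L) - lam * (3 * η ^ 2) * (2 * L) ≤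
      ∫ τ in closedBall t L, (gainDensity G lam γ₀ ξ τ - gainDensity G lam γ₀ γ τ) := by
  have hc : IsCompact (closedBall t L) := isCompact_closedBall t L
  have hm : MeasurableSet (γ.curve ⁻¹' G) := (hG.preimage γ.continuous_curve).measurableSet
  have hconst : ∀ C : ℝ, IntegrableOn (fun _ ↦ C) (closedBall t L) :=
    fun C ↦ integrableOn_const hc.measure_lt_top.ne
  have hball : IntegrableOn ((ball t a).indicator (1 : ℝ → ℝ)) (closedBall t L) :=
    (hconst 1).indicator measurableSet_ball
  have hpre := γ.integrableOn_indicator_preimage hG hc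
  have hqi : IntegrableOn (fun τ ↦ q τ * (2 * inner ℝ (γ.velocity t - γ₀.velocity t) u))
      (closedBall t L) := (hq.mul continuous_const).continuousOn.integrableOn_compact hc
  have hlin := (hqi.add (hconst (3 * η ^ 2))).const_mul lam
  have hI : ∫ τ in closedBall t L, ((ball t a).indicator (1 : ℝ → ℝ) τ -
      (γ.curve ⁻¹' G).indicator (1 : ℝ → ℝ) τ -
      lam * (q τ * (2 * inner ℝ (γ.velocity t - γ₀.velocity t) u) + 3 * η ^ 2)) =
      2 * a - volume.real (γ.curve ⁻¹' G ∩ closedBall t L) - lam * (3 * η ^ 2) * (2 * L) := by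
    have hlin' := integral_sub (hball.sub hpre) hlin
    simp only [Pi.sub_apply, Pi.add_apply] at hlin'
    rw [hlin', integral_sub hball hpre, integral_const_mul, integral_add hqi (hconst _),
      integral_mul_const, hq0, integral_indicator_one measurableSet_ball,
      integral_indicator_one hm, measureReal_restrict_apply hm,
      measureReal_restrict_apply measurableSet_ball,
      inter_eq_left.2 (ball_subset_closedBall.trans (closedBall_subset_closedBall haL)),
      setIntegral_const, Real.volume_real_ball ha, Real.volume_real_closedBall hL, smul_eq_mul]
    ring
  calc _ ≤ _ := by linarith
    _ = _ := hI.symm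
    _ ≤ _ := by
      refine setIntegral_mono_on ((hball.sub hpre).sub hlin)
        ((integrableOn_gainDensity hG lam γ₀ ξ hc).sub (integrableOn_gainDensity hG lam γ₀ γ hc))
        hc.measurableSet fun τ hτ ↦ ?_
      have h1 : (ball t a).indicator (1 : ℝ → ℝ) τ ≤ (ξ.curve ⁻¹' G).indicator 1 τ :=
        indicator_le_indicator_of_subset (fun τ hτ ↦ hξG τ hτ) (fun _ ↦ zero_le_one) τ
      have h2 := mul_le_mul_of_nonneg_left (norm_add_smul_sq_sub_le (hqη τ) (hosc τ hτ)) hlam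
      have h3 : ξ.velocity τ - γ₀.velocity τ = γ.velocity τ - γ₀.velocity τ + q τ • u := by
        rw [hξ τ hτ]
        abel
      rw [gainDensity, gainDensity, h3]
      linarith

/-- `L` is a scale at which the curve `γ` at time `t` sees the hole of centre `γ t + u` and of
radius `c * ‖u‖` inside `G`, while `γ` itself rarely visits `G` and has almost constant velocity
relative to `γ₀` on the time interval `[t - L, t + L]`. -/
structure IsHoleScale (G : Set H) (γ₀ γ : Gamma1 H) (c B η κ ε t L : ℝ) (u : H) : Prop where
  pos : 0 < L
  subset : closedBall t L ⊆ Icc 0 1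
  norm_eq : B * ‖u‖ = η * L
  norm_le : ‖u‖ ≤ ε
  osc : ∀ τ ∈ closedBall t L,
    ‖(γ.velocity τ - γ₀.velocity τ) - (γ.velocity t - γ₀.velocity t)‖ ≤ η
  density : volume.real (γ.curve ⁻¹' G ∩ closedBall t L) ≤ κ * (2 * L)
  hole : ball (γ.curve t + u) (c * ‖u‖) ⊆ G

lemma exists_isHoleScale {E : Set H} {c B η κ ε : ℝ} (hE : IsCPorous c E) (hB : 0 < B)
    (hη : 0 < η) (hκ : 0 < κ) (hε : 0 < ε) (γ₀ γ : Gamma1 H) {t : ℝ} (ht : t ∈ Ioo (0 : ℝ) 1)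
    (htE : γ.curve t ∈ E)
    (hden : Filter.Tendsto (fun r ↦ volume (γ.curve ⁻¹' (closure E)ᶜ ∩ closedBall t r) /
      volume (closedBall t r)) (𝓝[>] 0) (𝓝 0)) {δ : ℝ} (hδ : 0 < δ) :
    ∃ L ∈ Ioo 0 δ, ∃ u : H, IsHoleScale (closure E)ᶜ γ₀ γ c B η κ ε t L u := by
  obtain ⟨s₁, hs₁, hs₁'⟩ := Metric.nhds_basis_closedBall.mem_iff.1
    (Icc_mem_nhds ht.1 ht.2)
  have hcont : Continuous fun τ ↦ γ.velocity τ - γ₀.velocity τ :=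
    γ.continuous_velocity.sub γ₀.continuous_velocity
  obtain ⟨s₂, hs₂, hs₂'⟩ := Metric.nhds_basis_closedBall.mem_iff.1
    (hcont.continuousAt.preimage_mem_nhds (Metric.closedBall_mem_nhds _ hη) :
      _ ∈ 𝓝 t)
  obtain ⟨s₃, hs₃, hs₃'⟩ := mem_nhdsGT_iff_exists_Ioo_subset.1
    (hden.eventually_lt_const (ENNReal.ofReal_pos.2 hκ))
  have hs : 0 < min (min δ s₁) (min s₂ s₃) := by
    simp only [lt_min_iff]
    exact ⟨⟨hδ, hs₁⟩, hs₂, hs₃⟩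
  obtain ⟨h, r, hr, hd, hhole, hrc⟩ := hE _ htE (min ε (η * min (min δ s₁) (min s₂ s₃) / B))
    (lt_min hε (by positivity))
  rw [dist_comm, dist_eq_norm] at hd hrc
  rw [lt_min_iff, lt_div_iff₀ hB] at hd
  have hu : 0 < ‖h - γ.curve t‖ := by
    refine norm_pos_iff.2 (sub_ne_zero.2 ?_)
    rintro rfl
    exact (hhole ▸ ⟨mem_ball_self hr, htE⟩ : γ.curve t ∈ (∅ : Set H))
  have hL : B * ‖h - γ.curve t‖ / η < min (min δ s₁) (min s₂ s₃) := by
    rw [div_lt_iff₀ hη]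
    linarith [hd.2]
  have hL0 : 0 < B * ‖h - γ.curve t‖ / η := by positivity
  simp only [lt_min_iff] at hL
  refine ⟨_, ⟨hL0, hL.1.1⟩, h - γ.curve t, hL0,
    (closedBall_subset_closedBall hL.1.2.le).trans hs₁', by field_simp, hd.1.le,
    fun τ hτ ↦ ?_, ?_, ?_⟩
  · rw [← dist_eq_norm]
    exact hs₂' (closedBall_subset_closedBall hL.2.1.le hτ)
  · have h3 := hs₃' ⟨hL0, hL.2.2⟩
    rw [mem_ofPred_eq, Real.volume_closedBall, ENNReal.div_lt_iff (Or.inl (by simpa using hL0))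
      (Or.inl ENNReal.ofReal_ne_top), ← ENNReal.ofReal_mul hκ.le] at h3
    exact ENNReal.toReal_le_of_le_ofReal (by positivity) h3.le
  · rw [add_sub_cancel]
    refine (ball_subset_ball hrc.le).trans (disjoint_iff_inter_eq_empty.2 hhole
      |>.closure_right isOpen_ball).subset_compl_right

/-- Perturbing `γ` through finitely many holes seen at disjoint scales. -/
lemma exists_gain_add_le {G : Set H} (hG : IsOpen G) {b b' : ℝ → ℝ} {lam c B M η κ ε : ℝ}
    (hlam : 0 ≤ lam) (hc : 0 < c) (hB : 0 < B) (hM : 0 < M) (hη : 0 ≤ η) (hε : 0 ≤ ε)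
    (hcM : c * η ≤ B * M)
    (hb' : Continuous b') (hb : ∀ x, HasDerivAt b (b' x) x) (hb0 : b 0 = 1)
    (hb1 : ∀ x, |b x| ≤ 1) (hbB : ∀ x, |b' x| ≤ B) (hbz : ∀ x, 1 ≤ |x| → b x = 0 ∧ b' x = 0)
    {γ₀ γ : Gamma1 H} (hγM : ∀ t, ‖γ.velocity t‖ + η ≤ M) {F : Finset ℝ} {L : ℝ → ℝ} {u : ℝ → H}
    (hF : ∀ t ∈ F, IsHoleScale G γ₀ γ c B η κ ε t (L t) (u t))
    (hdisj : (F : Set ℝ).PairwiseDisjoint fun t ↦ closedBall t (L t)) :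
    ∃ ξ : Gamma1 H, (∀ τ ∈ Icc (0 : ℝ) 1, ‖ξ.curve τ - γ.curve τ‖ ≤ ε) ∧
      (∀ τ ∈ Icc (0 : ℝ) 1, ξ.velocity τ = γ.velocity τ ∨
        ∃ t ∈ F, τ ∈ closedBall t (L t) ∧ ‖ξ.velocity τ - γ.velocity τ‖ ≤ η) ∧
      gain G lam γ₀ γ + (c * η / (B * M) - κ - lam * (3 * η ^ 2)) * ∑ t ∈ F, 2 * L t ≤
        gain G lam γ₀ ξ := by
  let q : ℝ → ℝ → ℝ := fun t τ ↦ b' ((τ - t) / L t) * (1 / L t)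
  have hqc : ∀ t, Continuous (q t) := fun t ↦
    (hb'.comp (by fun_prop)).mul continuous_const
  have hbd : ∀ t τ, HasDerivAt (fun τ ↦ b ((τ - t) / L t)) (q t τ) τ := fun t τ ↦
    (hb ((τ - t) / L t)).comp τ (((hasDerivAt_id τ).sub_const t).div_const (L t))
  have hout : ∀ t ∈ F, ∀ τ, τ ∉ closedBall t (L t) → b ((τ - t) / L t) = 0 ∧ q t τ = 0 := by
    intro t ht τ hτ
    have h := hbz ((τ - t) / L t) (by
      rw [abs_div, abs_of_pos (hF t ht).pos, one_le_div (hF t ht).pos]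
      rw [mem_closedBall, Real.dist_eq, not_le] at hτ
      exact hτ.le)
    exact ⟨h.1, by simp [q, h.2]⟩
  have hqη : ∀ t ∈ F, ∀ τ, |q t τ| * ‖u t‖ ≤ η := by
    intro t ht τ
    have hL := (hF t ht).pos
    calc |q t τ| * ‖u t‖ = |b' ((τ - t) / L t)| * ‖u t‖ / L t := by
          simp only [q]
          rw [abs_mul, abs_of_pos (one_div_pos.2 hL)]
          ring
      _ ≤ B * ‖u t‖ / L t := by gcongr; exact hbB _
      _ = η := by rw [(hF t ht).norm_eq]; field_simp
  have hq0 : ∀ t ∈ F, ∫ τ in closedBall t (L t), q t τ = 0 := by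
    intro t ht
    have hL := (hF t ht).pos
    rw [Real.closedBall_eq_Icc, integral_Icc_eq_integral_Ioc,
      ← intervalIntegral.integral_of_le (by linarith),
      intervalIntegral.integral_eq_sub_of_hasDerivAt (fun τ _ ↦ hbd t τ)
        ((hqc t).intervalIntegrable _ _)]
    have h1 : (t + L t - t) / L t = 1 := by field_simp; ring
    have h2 : (t - L t - t) / L t = -1 := by field_simp; ring
    rw [h1, h2, (hbz 1 (by simp)).1, (hbz (-1) (by simp)).1, sub_zero]
  obtain ⟨ξ, hξ, hξ'⟩ := γ.exists_curve_eq_add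
    (p := fun τ ↦ ∑ t ∈ F, b ((τ - t) / L t) • u t) (p' := fun τ ↦ ∑ t ∈ F, q t τ • u t)
    (continuous_finsetSum _ fun t _ ↦ (hqc t).smul continuous_const)
    (fun τ ↦ HasDerivAt.fun_sum fun t _ ↦ (hbd t τ).smul_const (u t))
  have hnotMem : ∀ t ∈ F, ∀ τ ∈ closedBall t (L t), ∀ s ∈ F, s ≠ t → τ ∉ closedBall s (L s) :=
    fun t ht τ hτ s hs hst h ↦ (hdisj hs ht hst).le_bot ⟨h, hτ⟩
  have hin : ∀ t ∈ F, ∀ τ ∈ closedBall t (L t),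
      ξ.curve τ = γ.curve τ + b ((τ - t) / L t) • u t ∧
        ξ.velocity τ = γ.velocity τ + q t τ • u t := by
    intro t ht τ hτ
    have hτ' := (hF t ht).subset hτ
    rw [hξ τ hτ', hξ' τ hτ', Finset.sum_eq_single_of_mem t ht, Finset.sum_eq_single_of_mem t ht]
    · exact ⟨rfl, rfl⟩
    · intro s hs hst
      rw [(hout s hs τ (hnotMem t ht τ hτ s hs hst)).2, zero_smul]
    · intro s hs hst
      rw [(hout s hs τ (hnotMem t ht τ hτ s hs hst)).1, zero_smul]
  have hoff : ∀ τ ∈ Icc (0 : ℝ) 1, (∀ t ∈ F, τ ∉ closedBall t (L t)) →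
      ξ.curve τ = γ.curve τ ∧ ξ.velocity τ = γ.velocity τ := by
    intro τ hτ h
    rw [hξ τ hτ, hξ' τ hτ,
      Finset.sum_eq_zero fun t ht ↦ by rw [(hout t ht τ (h t ht)).1, zero_smul],
      Finset.sum_eq_zero fun t ht ↦ by rw [(hout t ht τ (h t ht)).2, zero_smul]]
    simp
  have hvel : ∀ τ ∈ Icc (0 : ℝ) 1, ξ.velocity τ = γ.velocity τ ∨
      ∃ t ∈ F, τ ∈ closedBall t (L t) ∧ ‖ξ.velocity τ - γ.velocity τ‖ ≤ η := by
    intro τ hτ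
    by_cases h : ∃ t ∈ F, τ ∈ closedBall t (L t)
    · obtain ⟨t, ht, htτ⟩ := h
      refine Or.inr ⟨t, ht, htτ, ?_⟩
      rw [(hin t ht τ htτ).2, add_sub_cancel_left, norm_smul, Real.norm_eq_abs]
      exact hqη t ht τ
    · push Not at h
      exact Or.inl (hoff τ hτ h).2
  refine ⟨ξ, fun τ hτ ↦ ?_, hvel, ?_⟩
  · by_cases h : ∃ t ∈ F, τ ∈ closedBall t (L t)
    · obtain ⟨t, ht, htτ⟩ := h
      rw [(hin t ht τ htτ).1, add_sub_cancel_left, norm_smul, Real.norm_eq_abs]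
      exact (mul_le_of_le_one_left (norm_nonneg _) (hb1 _)).trans (hF t ht).norm_le
    · push Not at h
      simpa [(hoff τ hτ h).1] using hε
  have hξM : ∀ τ ∈ Icc (0 : ℝ) 1, ‖ξ.velocity τ‖ ≤ M := by
    intro τ hτ
    rcases hvel τ hτ with h | ⟨_, _, _, h⟩
    · rw [h]
      linarith [hγM τ]
    · linarith [hγM τ, norm_le_norm_add_norm_sub' (ξ.velocity τ) (γ.velocity τ)]
  have hdiff := integral_sub (integrableOn_gainDensity hG lam γ₀ ξ isCompact_Icc)
    (integrableOn_gainDensity hG lam γ₀ γ (isCompact_Icc (a := (0 : ℝ)) (b := 1)))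
  rw [setIntegral_eq_of_subset_of_forall_sdiff_eq_zero
      (s := ⋃ t ∈ F, closedBall t (L t)) measurableSet_Icc
      (iUnion₂_subset fun t ht ↦ (hF t ht).subset),
    integral_biUnion_finset (f := fun τ ↦ gainDensity G lam γ₀ ξ τ - gainDensity G lam γ₀ γ τ)
      F (fun _ _ ↦ measurableSet_closedBall) hdisj fun t _ ↦
      (integrableOn_gainDensity hG lam γ₀ ξ (isCompact_closedBall _ _)).sub
        (integrableOn_gainDensity hG lam γ₀ γ (isCompact_closedBall _ _))] at hdiff
  · have hsum : (c * η / (B * M) - κ - lam * (3 * η ^ 2)) * ∑ t ∈ F, 2 * L t ≤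
        gain G lam γ₀ ξ - gain G lam γ₀ γ := by
      unfold gain
      rw [← hdiff, Finset.mul_sum]
      refine Finset.sum_le_sum fun t ht ↦ ?_
      have hL := (hF t ht).pos
      have htm : t ∈ closedBall t (L t) := mem_closedBall_self hL.le
      have haL : c * η / (B * M) * L t ≤ L t :=
        mul_le_of_le_one_left hL.le ((div_le_one (by positivity)).2 hcM)
      refine le_trans (le_of_eq ?_) (le_setIntegral_gainDensity_sub hG hlam hL.le
        (a := c * η / (B * M) * L t) (by positivity) haL (hqc t) (hq0 t ht) (hqη t ht)
        (fun τ hτ ↦ (hin t ht τ hτ).2) (hF t ht).osc (fun τ hτ ↦ (hF t ht).hole ?_)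
        (hF t ht).density)
      · ring
      · have hξt : ξ.curve t = γ.curve t + u t := by simp [(hin t ht t htm).1, hb0]
        rw [← hξt, mem_ball, dist_eq_norm]
        refine (ξ.norm_curve_sub_curve_le hξM ((hF t ht).subset
          (closedBall_subset_closedBall haL (ball_subset_closedBall hτ)))
          ((hF t ht).subset htm)).trans_lt ?_
        rw [mem_ball, Real.dist_eq] at hτ
        calc M * |τ - t| < M * (c * η / (B * M) * L t) := by gcongr
          _ = c * (η * L t) / B := by field_simp
          _ = c * ‖u t‖ := by rw [← (hF t ht).norm_eq]; field_simp
    linarith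
  · rintro τ ⟨hτ, hτ'⟩
    simp only [mem_iUnion, not_exists] at hτ'
    have h := hoff τ hτ hτ'
    have hmem : τ ∈ ξ.curve ⁻¹' G ↔ τ ∈ γ.curve ⁻¹' G := by rw [mem_preimage, mem_preimage, h.1]
    classical
    rw [gainDensity, gainDensity, h.2, indicator_apply, indicator_apply]
    simp only [hmem, sub_self]

end Perturbation

/-- A finite version of the Besicovitch covering theorem on the line. -/
lemma exists_finset_disjoint_closedBall {T : Set ℝ} {f : ℝ → Set ℝ}
    (hf : ∀ x ∈ T, ∀ δ > 0, (f x ∩ Ioo 0 δ).Nonempty) {m : ℝ} (hm : 0 ≤ m)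
    (hT : ENNReal.ofReal m < volume T) :
    ∃ (F : Finset ℝ) (r : ℝ → ℝ), (∀ x ∈ F, x ∈ T ∧ r x ∈ f x) ∧
      (F : Set ℝ).PairwiseDisjoint (fun x ↦ closedBall x (r x)) ∧ m < ∑ x ∈ F, 2 * r x := by
  obtain ⟨t, r, htc, htT, hr, hcov, hdisj⟩ :=
    Besicovitch.exists_disjoint_closedBall_covering_ae volume f T hf 1 fun _ _ ↦ one_pos
  have := htc.to_subtype
  have hle : volume T ≤ ∑' x : t, volume (closedBall (x : ℝ) (r x)) :=
    calc volume T ≤ volume (T \ ⋃ x ∈ t, closedBall x (r x)) +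
          volume (⋃ x ∈ t, closedBall x (r x)) :=
          (measure_mono (by rw [sdiff_union_self]; exact subset_union_left)).trans
            (measure_union_le _ _)
      _ ≤ _ := by
        rw [hcov, zero_add]
        exact measure_biUnion_le _ htc _
  have hlt := hT.trans_le hle
  rw [ENNReal.tsum_eq_iSup_sum, lt_iSup_iff] at hlt
  obtain ⟨s, hs⟩ := hlt
  have hsub : ∀ x ∈ s.map (Function.Embedding.subtype _), x ∈ t := by
    intro x hx
    obtain ⟨y, -, rfl⟩ := Finset.mem_map.1 hx
    exact y.2
  refine ⟨s.map (Function.Embedding.subtype _), r,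
    fun x hx ↦ ⟨htT (hsub x hx), (hr x (hsub x hx)).1⟩, hdisj.subset hsub, ?_⟩
  rw [Finset.sum_map]
  simp only [Real.volume_closedBall] at hs
  rw [← ENNReal.ofReal_sum_of_nonneg
    fun (x : t) _ ↦ mul_nonneg zero_le_two (hr x x.2).2.1.le] at hs
  exact (ENNReal.ofReal_lt_ofReal_iff_of_nonneg hm).1 hs

section Porous

variable {H : Type*} [NormedAddCommGroup H] [InnerProductSpace ℝ H]

/-- Up to a set of measure `δ / 2`, the times in `E` are density points of the times in `closure E`
at which the velocity of `γ` is close to that of `γ₀`. -/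
lemma lt_volume_density_points {E : Set H} {γ₀ γ : Gamma1 H} {δ ρ : ℝ} (hδ : 0 < δ) (hρ : 0 < ρ)
    (hγ : ENNReal.ofReal δ < γ.measOn E)
    (hen : ∫ t in Icc 0 1, ‖γ.velocity t - γ₀.velocity t‖ ^ 2 ≤ δ / 2 * ρ ^ 2) :
    ENNReal.ofReal (δ / 2) < volume {t | t ∈ Ioo (0 : ℝ) 1 ∧ γ.curve t ∈ E ∧
      ‖γ.velocity t - γ₀.velocity t‖ < ρ ∧
      Filter.Tendsto (fun r ↦ volume (γ.curve ⁻¹' (closure E)ᶜ ∩ closedBall t r) /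
        volume (closedBall t r)) (𝓝[>] 0) (𝓝 0)} := by
  set T := {t | t ∈ Ioo (0 : ℝ) 1 ∧ γ.curve t ∈ E ∧ ‖γ.velocity t - γ₀.velocity t‖ < ρ ∧
      Filter.Tendsto (fun r ↦ volume (γ.curve ⁻¹' (closure E)ᶜ ∩ closedBall t r) /
        volume (closedBall t r)) (𝓝[>] 0) (𝓝 0)}
  let D := {t | ρ ^ 2 ≤ ‖γ.velocity t - γ₀.velocity t‖ ^ 2}
  have hD : volume (Icc 0 1 ∩ D) ≤ ENNReal.ofReal (δ / 2) := by
    have hDm : MeasurableSet D := (isClosed_le continuous_const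
      ((γ.continuous_velocity.sub γ₀.continuous_velocity).norm.pow 2)).measurableSet
    have h := (mul_meas_ge_le_integral_of_nonneg
      (Filter.Eventually.of_forall fun t ↦ sq_nonneg ‖γ.velocity t - γ₀.velocity t‖)
      (integrableOn_energy γ₀ γ (isCompact_Icc (a := (0 : ℝ)) (b := 1))) (ρ ^ 2)).trans hen
    rw [measureReal_restrict_apply hDm, mul_comm (δ / 2), inter_comm,
      mul_le_mul_iff_right₀ (by positivity)] at h
    refine (ENNReal.le_ofReal_iff_toReal_le ?_ (by positivity)).2 h
    exact ((measure_mono inter_subset_left).trans_lt isCompact_Icc.measure_lt_top).ne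
  have hsub : (Icc 0 1 ∩ γ.curve ⁻¹' E : Set ℝ) ≤ᵐ[volume] (T ∪ (Icc 0 1 ∩ D) : Set ℝ) := by
    filter_upwards [Besicovitch.ae_tendsto_measure_inter_div_of_measurableSet volume
      (isClosed_closure.isOpen_compl.preimage γ.continuous_curve :
        IsOpen (γ.curve ⁻¹' (closure E)ᶜ)).measurableSet,
      (Ioo_ae_eq_Icc (μ := volume) (a := (0 : ℝ)) (b := 1)).mem_iff]
      with t ht hIoo
    rintro ⟨ht01, htE⟩
    by_cases htD : t ∈ D
    · exact Or.inr ⟨ht01, htD⟩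
    · have htG : t ∉ γ.curve ⁻¹' (closure E)ᶜ := fun h ↦ h (subset_closure htE)
      rw [indicator_of_notMem htG] at ht
      exact Or.inl ⟨hIoo.2 ht01, htE, lt_of_pow_lt_pow_left₀ 2 hρ.le (not_le.1 htD), ht⟩
  rw [measOn_eq] at hγ
  by_contra! hT
  refine hγ.not_ge ((measure_mono_ae hsub).trans ((measure_union_le _ _).trans
    ((add_le_add hT hD).trans_eq ?_)))
  rw [← ENNReal.ofReal_add (by positivity) (by positivity), add_halves]

/-- A curve spending a definite amount of time in a porous set can be perturbed so as to increase
`gain` by a definite amount. -/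
lemma exists_lt_gain {E : Set H} {b b' : ℝ → ℝ} {lam c B M η ρ δ : ℝ} (hE : IsCPorous c E)
    (hlam : 0 ≤ lam) (hc : 0 < c) (hB : 0 < B) (hM : 0 < M) (hη : 0 < η) (hδ : 0 < δ)
    (hρ : 0 < ρ) (hcM : c * η ≤ B * M) (hηρ : 8 * η < ρ)
    (hηlam : lam * (3 * η ^ 2) ≤ c * η / (B * M) / 4)
    (hb' : Continuous b') (hb : ∀ x, HasDerivAt b (b' x) x) (hb0 : b 0 = 1)
    (hb1 : ∀ x, |b x| ≤ 1) (hbB : ∀ x, |b' x| ≤ B) (hbz : ∀ x, 1 ≤ |x| → b x = 0 ∧ b' x = 0)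
    {γ₀ γ : Gamma1 H} (hγM : ∀ t, ‖γ.velocity t‖ + η ≤ M)
    (hγ : ENNReal.ofReal δ < γ.measOn E) (hγ1 : ‖γ.1.1 - γ₀.1.1‖ < ρ / 2)
    (hγ2 : ‖γ.1.2 - γ₀.1.2‖ < ρ / 2)
    (hen : ∫ t in Icc 0 1, ‖γ.velocity t - γ₀.velocity t‖ ^ 2 ≤ δ / 2 * (ρ / 4) ^ 2) :
    ∃ ξ : Gamma1 H, ‖ξ.1.1 - γ₀.1.1‖ < ρ / 2 ∧ ‖ξ.1.2 - γ₀.1.2‖ < ρ / 2 ∧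
      gain (closure E)ᶜ lam γ₀ γ + c * η / (B * M) / 4 * (δ / 2) ≤
        gain (closure E)ᶜ lam γ₀ ξ := by
  have hG : IsOpen (closure E)ᶜ := isClosed_closure.isOpen_compl
  obtain ⟨ε, hε, hε'⟩ := exists_between (sub_pos.2 hγ1)
  obtain ⟨F, L, hF, hdisj, hsum⟩ := exists_finset_disjoint_closedBall
    (f := fun t ↦ {L | ∃ u, IsHoleScale (closure E)ᶜ γ₀ γ c B η (c * η / (B * M) / 2) ε t L u})
    (fun t ht s hs ↦ by
      obtain ⟨L, hL, u, hu⟩ := exists_isHoleScale hE hB hη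
        (by positivity : 0 < c * η / (B * M) / 2) hε γ₀ γ ht.1 ht.2.1 ht.2.2.2 hs
      exact ⟨L, ⟨u, hu⟩, hL⟩)
    (by positivity) (lt_volume_density_points hδ (by positivity : 0 < ρ / 4) hγ hen)
  choose! u hu using fun t ht ↦ (hF t ht).2
  obtain ⟨ξ, hξ1, hξ2, hξ3⟩ := exists_gain_add_le hG hlam hc hB hM hη.le hε.le hcM hb' hb hb0 hb1
    hbB hbz hγM hu hdisj
  refine ⟨ξ, ?_, ?_, le_trans ?_ hξ3⟩
  · have h := norm_position_sub_le_of_forall hε.le hξ1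
    linarith [norm_sub_le_norm_sub_add_norm_sub ξ.1.1 γ.1.1 γ₀.1.1]
  · refine (norm_speed_sub_le_of_forall (C := max ‖γ.1.2 - γ₀.1.2‖ (ρ / 4 + 2 * η))
      (le_max_of_le_left (norm_nonneg _)) fun τ hτ ↦ ?_).trans_lt (max_lt hγ2 (by linarith))
    rcases hξ2 τ hτ with h | ⟨t, ht, htτ, h⟩
    · rw [h]
      exact le_max_of_le_left (norm_velocity_sub_le γ γ₀ τ)
    · refine le_max_of_le_right ?_
      have h1 := (hu t ht).osc τ htτ
      have h2 := (hF t ht).1.2.2.1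
      have h3 := norm_le_norm_add_norm_sub' (γ.velocity τ - γ₀.velocity τ)
        (γ.velocity t - γ₀.velocity t)
      linarith [norm_sub_le_norm_sub_add_norm_sub (ξ.velocity τ) (γ.velocity τ) (γ₀.velocity τ)]
  · have hpos : 0 < c * η / (B * M) / 4 := by positivity
    refine add_le_add_right (mul_le_mul ?_ hsum.le (by positivity) ?_) _ <;> linarith

lemma isNowhereDense_lt_measOn {E : Set H} {c δ : ℝ} (hc : 0 < c) (hE : IsCPorous c E)
    (hδ : 0 < δ) : IsNowhereDense {γ : Gamma1 H | ENNReal.ofReal δ < γ.measOn E} := by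
  obtain ⟨b, b', B, hB1, hb', hb, hb0, hb1, hbB, hbz⟩ := exists_contDiff_bump
  have hB : 0 < B := one_pos.trans_le hB1
  refine eq_empty_of_forall_notMem fun γ₀ hγ₀ ↦ ?_
  obtain ⟨ρ, hρ, hball⟩ := Metric.isOpen_iff.1 isOpen_interior γ₀ hγ₀
  have hG : IsOpen (closure E)ᶜ := isClosed_closure.isOpen_compl
  set lam := 64 / (δ * ρ ^ 2) with hlam
  have hlam0 : 0 < lam := by positivity
  set M := ‖γ₀.1.2‖ + ρ + 1 with hM
  have hM0 : 0 < M := by positivity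
  obtain ⟨η, hη, hη'⟩ := exists_between
    (lt_min (lt_min (by positivity : 0 < ρ / 8) (by positivity : 0 < c / (12 * lam * B * M)))
      (by positivity : 0 < B * M / c))
  simp only [lt_min_iff] at hη'
  obtain ⟨⟨hη1, hη2⟩, hη3⟩ := hη'
  have hηlam : lam * (3 * η ^ 2) ≤ c * η / (B * M) / 4 := by
    rw [lt_div_iff₀ (by positivity)] at hη2
    rw [div_div, le_div_iff₀ (by positivity)]
    nlinarith
  have hcM : c * η ≤ B * M := by
    rw [lt_div_iff₀ hc] at hη3
    linarith
  set U := {γ : Gamma1 H | ‖γ.1.1 - γ₀.1.1‖ < ρ / 2 ∧ ‖γ.1.2 - γ₀.1.2‖ < ρ / 2}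
  have hU : IsOpen U :=
    (isOpen_lt (continuous_position.sub continuous_const).norm continuous_const).inter
      (isOpen_lt (continuous_speed.sub continuous_const).norm continuous_const)
  have hγ₀U : γ₀ ∈ U := by simp [U, hρ]
  have hbdd : BddAbove (gain (closure E)ᶜ lam γ₀ '' U) := by
    refine ⟨1, forall_mem_image.2 fun γ _ ↦ ?_⟩
    have h : 0 ≤ lam * ∫ t in Icc 0 1, ‖γ.velocity t - γ₀.velocity t‖ ^ 2 :=
      mul_nonneg hlam0.le (integral_nonneg fun _ ↦ by positivity)
    linarith [gain_add_energy_le_one hG lam γ₀ γ]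
  set S := sSup (gain (closure E)ᶜ lam γ₀ '' U)
  have hS : ∀ γ ∈ U, gain (closure E)ᶜ lam γ₀ γ ≤ S := fun γ hγ ↦
    le_csSup hbdd (mem_image_of_mem _ hγ)
  have hS0 : 0 ≤ S := (gain_self_nonneg hG lam γ₀).trans (hS γ₀ hγ₀U)
  obtain ⟨σ, hσ, hσ'⟩ := exists_between
    (lt_min one_pos (by positivity : 0 < c * η / (B * M) / 4 * (δ / 2)))
  rw [lt_min_iff] at hσ'
  obtain ⟨_, ⟨γ₁, hγ₁U, rfl⟩, hγ₁⟩ := exists_lt_of_lt_csSup ⟨_, mem_image_of_mem _ hγ₀U⟩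
    (sub_lt_self S hσ)
  have hγ₁cl : γ₁ ∈ closure {γ : Gamma1 H | ENNReal.ofReal δ < γ.measOn E} := by
    refine interior_subset (hball ?_)
    rw [mem_ball, dist_def]
    linarith [hγ₁U.1, hγ₁U.2]
  obtain ⟨γ, ⟨hγU, hγS⟩, hγδ⟩ := mem_closure_iff.1 hγ₁cl _
    (hU.inter ((lowerSemicontinuous_gain hG lam γ₀).isOpen_preimage (S - σ))) ⟨hγ₁U, hγ₁⟩
  rw [mem_preimage, mem_Ioi] at hγS
  have hγM : ∀ t, ‖γ.velocity t‖ + η ≤ M := fun t ↦ by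
    have h1 : ‖γ.velocity t‖ ≤ ‖γ.1.2‖ :=
      γ.1.2.norm_coe_le_norm (projIcc 0 1 zero_le_one t)
    linarith [norm_le_norm_add_norm_sub' γ.1.2 γ₀.1.2, hγU.2]
  have hen : ∫ t in Icc 0 1, ‖γ.velocity t - γ₀.velocity t‖ ^ 2 ≤ δ / 2 * (ρ / 4) ^ 2 := by
    have h' : lam * ∫ t in Icc 0 1, ‖γ.velocity t - γ₀.velocity t‖ ^ 2 ≤ 2 := by
      linarith [gain_add_energy_le_one hG lam γ₀ γ]
    refine le_of_mul_le_mul_left (h'.trans_eq ?_) hlam0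
    rw [hlam]
    field_simp
    norm_num
  obtain ⟨ξ, hξ1, hξ2, hξ⟩ := exists_lt_gain hE hlam0.le hc hB hM0 hη hδ hρ hcM (by linarith) hηlam
    hb' hb hb0 hb1 hbB hbz hγM hγδ hγU.1 hγU.2 hen
  linarith [hS ξ ⟨hξ1, hξ2⟩]

lemma measOn_eq_zero_mem_residual {E : Set H} {c : ℝ} (hc : 0 < c) (hE : IsCPorous c E) :
    {γ : Gamma1 H | γ.measOn E = 0} ∈ residual (Gamma1 H) := by
  have h : IsMeagre (⋃ n : ℕ,
      {γ : Gamma1 H | ENNReal.ofReal (1 / ((n : ℝ) + 1)) < γ.measOn E}) :=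
    isMeagre_iUnion fun n ↦
      (isNowhereDense_lt_measOn hc hE (by positivity : 0 < 1 / ((n : ℝ) + 1))).isMeagre
  refine Filter.mem_of_superset h fun γ hγ ↦ ?_
  simp only [mem_compl_iff, mem_iUnion, mem_ofPred_eq, not_exists, not_lt] at hγ
  have ht : Filter.Tendsto (fun n : ℕ ↦ ENNReal.ofReal (1 / ((n : ℝ) + 1))) Filter.atTop (𝓝 0) := by
    simpa using ENNReal.tendsto_ofReal (tendsto_one_div_add_atTop_nhds_zero_nat (𝕜 := ℝ))
  exact nonpos_iff_eq_zero.1 (ge_of_tendsto' ht hγ)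

end Porous

end Gamma1

/-- Every σ-porous subset of a real Hilbert space `H` is `Γ₁`-null:
the set of curves `γ ∈ Γ₁(H)` such that `{t ∈ [0,1] : γ(t) ∈ P}` has outer Lebesgue
measure zero is residual (comeager) in `Γ₁(H)`. -/
theorem sigmaPorous_isGammaOneNull {H : Type*} [NormedAddCommGroup H]
    [InnerProductSpace ℝ H] [CompleteSpace H] {P : Set H} (hP : IsSigmaPorous P) :
    {γ : Gamma1 H | Gamma1.measOn γ P = 0} ∈ residual (Gamma1 H) := by
  obtain ⟨E, rfl, hE⟩ := hP
  choose c hc _ hE using hE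
  filter_upwards [eventually_countable_forall.2 fun n ↦
    Gamma1.measOn_eq_zero_mem_residual (hc n) (hE n)] with γ hγ
  rw [Gamma1.measOn_eq, preimage_iUnion, inter_iUnion, measure_iUnion_null_iff]
  exact fun n ↦ (γ.measOn_eq (E n)).symm.trans (hγ n)

end
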